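/- Strong duality for the KL entropy transport problem: with D_{Λ,KL-dual}(u,v|μ,ν) = ∫ Λ(1 − e^{−u/Λ}) dμ + ∫ Λ(1 − e^{−v/Λ}) dν, one has inf over γ ∈ M(ℝ^d × ℝ^d) of E_{Λ,KL}(γ|μ,ν) = sup over continuous u, v: ℝ^d → ℝ with u(x) + v(y) ≤ c(x,y) for all x, y, of D_{Λ,KL-dual}(u,v|μ,ν). -/

import Mathlib

open MeasureTheory ENNReal Filter
open scoped Classical NNReal

/-- The divergence functional `D(σ‖λ) = ∫ F(dσ/dλ) dλ` if `σ ≪ λ`, and `+∞` otherwise. -/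
noncomputable def divergenceF {α : Type*} [MeasurableSpace α]
    (F : ℝ≥0∞ → ℝ≥0∞) (σ lam : Measure α) : ℝ≥0∞ :=
  if σ ≪ lam then ∫⁻ x, F (σ.rnDeriv lam x) ∂lam else ⊤

/-- The entropy function `F(s) = s log s - s + 1` (equal to `+∞` at `s = +∞`),
generating the Kullback-Leibler divergence. -/
noncomputable def Fkl : ℝ≥0∞ → ℝ≥0∞ := fun r =>
  if r = ⊤ then ⊤ else ENNReal.ofReal (r.toReal * Real.log r.toReal - r.toReal + 1)

/-- The KL entropy transport functional
`E_{Λ,KL}(γ|μ,ν) = ∬ c dγ + Λ D_KL(π₁#γ‖μ) + Λ D_KL(π₂#γ‖ν)`. -/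
noncomputable def ETKL {d : ℕ}
    (c : EuclideanSpace ℝ (Fin d) × EuclideanSpace ℝ (Fin d) → ℝ≥0∞) (Λ : ℝ)
    (μ ν : Measure (EuclideanSpace ℝ (Fin d)))
    (γ : Measure (EuclideanSpace ℝ (Fin d) × EuclideanSpace ℝ (Fin d))) : ℝ≥0∞ :=
  ∫⁻ p, c p ∂γ + ENNReal.ofReal Λ * divergenceF Fkl (γ.map Prod.fst) μ
    + ENNReal.ofReal Λ * divergenceF Fkl (γ.map Prod.snd) ν

/-- The dual functional `D_{Λ,KL-dual}(u,v|μ,ν) = ∫ Λ(1 − e^{−u/Λ}) dμ + ∫ Λ(1 − e^{−v/Λ}) dν`,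
written in the extended reals (for probability measures `μ, ν`) as
`(Λ − ∫⁻ Λ e^{−u/Λ} dμ) + (Λ − ∫⁻ Λ e^{−v/Λ} dν)`. -/
noncomputable def dualKL {d : ℕ} (Λ : ℝ) (μ ν : Measure (EuclideanSpace ℝ (Fin d)))
    (u v : EuclideanSpace ℝ (Fin d) → ℝ) : EReal :=
  ((Λ : EReal) - ((∫⁻ x, ENNReal.ofReal (Λ * Real.exp (-(u x) / Λ)) ∂μ : ℝ≥0∞) : EReal))
    + ((Λ : EReal) - ((∫⁻ x, ENNReal.ofReal (Λ * Real.exp (-(v x) / Λ)) ∂ν : ℝ≥0∞) : EReal))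

open scoped BoundedContinuousFunction CompactlySupported Topology

noncomputable def ccToBcf {Z : Type*} [TopologicalSpace Z] (f : C_c(Z, ℝ)) : Z →ᵇ ℝ :=
  BoundedContinuousFunction.ofNormedAddCommGroup f f.continuous
    (f.hasCompactSupport.exists_bound_of_continuous f.continuous).choose
    (f.hasCompactSupport.exists_bound_of_continuous f.continuous).choose_spec

@[simp] lemma ccToBcf_apply {Z : Type*} [TopologicalSpace Z] (f : C_c(Z, ℝ)) (z : Z) :
    ccToBcf f z = f z := rfl

theorem riesz_tight {Z : Type*} [MetricSpace Z] [ProperSpace Z] [MeasurableSpace Z] [BorelSpace Z]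
    (l : (Z →ᵇ ℝ) →ₗ[ℝ] ℝ) (hpos : ∀ f : Z →ᵇ ℝ, (∀ z, 0 ≤ f z) → 0 ≤ l f)
    (htight : ∀ ε > 0, ∃ θ : C_c(Z, ℝ), (∀ z, 0 ≤ θ z ∧ θ z ≤ 1) ∧ l (1 - ccToBcf θ) ≤ ε) :
    ∃ γ : Measure Z, IsFiniteMeasure γ ∧ ∀ f : Z →ᵇ ℝ, ∫ z, f z ∂γ = l f := by
  have hmono : ∀ f g : Z →ᵇ ℝ, (∀ z, f z ≤ g z) → l f ≤ l g := by
    intro f g h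
    have := hpos (g - f) (fun z => by simpa using h z)
    rw [map_sub] at this; linarith
  let L : C_c(Z, ℝ) →ₚ[ℝ] ℝ := PositiveLinearMap.mk₀
    { toFun := fun f => l (ccToBcf f)
      map_add' := fun f g => by
        rw [← map_add]; congr 1
      map_smul' := fun a f => by
        rw [RingHom.id_apply, ← map_smul]; congr 1 }
    (fun f hf => hpos _ (fun z => hf z))
  have hL : ∀ f, L f = l (ccToBcf f) := fun f => rfl
  set γ := RealRMK.rieszMeasure L with hγ
  have hIntg : ∀ f : C_c(Z, ℝ), ∫ z, f z ∂γ = l (ccToBcf f) := fun f =>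
    RealRMK.integral_rieszMeasure L f
  have huniv : γ Set.univ ≤ ENNReal.ofReal (l 1) := by
    have : γ.Regular := by rw [hγ]; infer_instance
    rw [isOpen_univ.measure_eq_iSup_isCompact]
    refine iSup₂_le fun K _ => iSup_le fun hK => ?_
    obtain ⟨f, hf1, hf0, hfc, hf01⟩ := exists_continuous_one_zero_of_isCompact hK isClosed_empty
      (Set.disjoint_empty K)
    let F : C_c(Z, ℝ) := ⟨f, hfc⟩
    refine (RealRMK.rieszMeasure_le_of_eq_one L (f := F) (fun z => (hf01 z).1) hK
      (fun z hz => hf1 hz)).trans (ENNReal.ofReal_le_ofReal ?_)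
    rw [hL]
    exact hmono _ _ fun z => (hf01 z).2
  have hfin : IsFiniteMeasure γ := ⟨huniv.trans_lt ENNReal.ofReal_lt_top⟩
  refine ⟨γ, hfin, fun f => ?_⟩
  have hu : γ.real Set.univ ≤ l 1 := by
    have : 0 ≤ l 1 := hpos _ (fun z => by simp)
    exact ENNReal.toReal_le_of_le_ofReal this huniv
  have key : ∀ ε > 0, |∫ z, f z ∂γ - l f| ≤ 2 * ‖f‖ * ε := by
    intro ε hε
    obtain ⟨θ, hθ, hle⟩ := htight ε hε
    let fθ : C_c(Z, ℝ) := ⟨⟨fun z => f z * θ z, f.continuous.mul θ.continuous⟩,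
      θ.hasCompactSupport.mul_left⟩
    have h1 := hIntg fθ
    have h2 : ∀ z, fθ z = f z * θ z := fun z => rfl
    let g : Z →ᵇ ℝ := f - ccToBcf fθ
    let k : Z →ᵇ ℝ := 1 - ccToBcf θ
    have hgk : ∀ z, |g z| ≤ ‖f‖ * k z := by
      intro z
      have : g z = f z * (1 - θ z) := by simp [g, h2]; ring
      rw [this, abs_mul, abs_of_nonneg (by linarith [(hθ z).2] : (0:ℝ) ≤ 1 - θ z)]
      exact mul_le_mul_of_nonneg_right (f.norm_coe_le_norm z) (by linarith [(hθ z).2])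
    have hlg : |l g| ≤ ‖f‖ * l k := by
      rw [abs_le, ← smul_eq_mul, ← map_smul, ← map_neg]
      refine ⟨hmono _ _ fun z => ?_, hmono _ _ fun z => ?_⟩
      · simpa using (abs_le.1 (hgk z)).1
      · simpa using (abs_le.1 (hgk z)).2
    have hik : ∫ z, k z ∂γ ≤ l k := by
      have : ∫ z, k z ∂γ = γ.real Set.univ - ∫ z, θ z ∂γ := by
        have e : ∀ z, k z = 1 - θ z := fun z => rfl
        simp_rw [e]
        have hi : Integrable (fun z => θ z) γ := (ccToBcf θ).integrable γ
        rw [integral_sub (integrable_const _) hi]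
        simp
      rw [this, hIntg, map_sub]; linarith
    have hig : |∫ z, g z ∂γ| ≤ ‖f‖ * l k := by
      refine (abs_integral_le_integral_abs).trans ?_
      refine (integral_mono (g.integrable γ).abs ((k.integrable γ).const_mul ‖f‖) hgk).trans ?_
      rw [integral_const_mul]
      exact mul_le_mul_of_nonneg_left hik (norm_nonneg _)
    have e1 : ∫ z, g z ∂γ = ∫ z, f z ∂γ - l (ccToBcf fθ) := by
      rw [← h1]
      exact integral_sub (f.integrable γ) ((ccToBcf fθ).integrable γ)
    have e2 : l g = l f - l (ccToBcf fθ) := map_sub _ _ _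
    have : ∫ z, f z ∂γ - l f = ∫ z, g z ∂γ - l g := by rw [e1, e2]; ring
    rw [this]
    refine (abs_sub _ _).trans ?_
    have := mul_le_mul_of_nonneg_left hle (norm_nonneg f)
    change ‖f‖ * l k ≤ _ at this
    linarith
  have h0 : |∫ z, f z ∂γ - l f| ≤ 0 := by
    refine le_of_forall_pos_le_add fun ε hε => ?_
    have hp : 0 < 2 * ‖f‖ + 1 := by positivity
    refine (key (ε / (2 * ‖f‖ + 1)) (by positivity)).trans ?_
    rw [← mul_div_assoc, div_le_iff₀ hp]
    nlinarith [norm_nonneg f]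
  exact sub_eq_zero.1 (abs_eq_zero.1 (le_antisymm h0 (abs_nonneg _)))

theorem kl_dual_meas {X : Type*} [MetricSpace X] [MeasurableSpace X] [BorelSpace X]
    (μ σ : Measure X) [IsProbabilityMeasure μ] [IsFiniteMeasure σ] (K : ℝ)
    (h : ∀ s : X →ᵇ ℝ, ∫ x, s x ∂σ - ∫ x, (Real.exp (s x) - 1) ∂μ ≤ K)
    (s : X → ℝ) (hs : Measurable s) (B : ℝ) (hB : ∀ x, |s x| ≤ B) :
    ∫ x, s x ∂σ - ∫ x, (Real.exp (s x) - 1) ∂μ ≤ K := by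
  have hB0 : 0 ≤ B := by
    obtain ⟨x⟩ : Nonempty X := nonempty_of_isProbabilityMeasure μ
    exact (abs_nonneg _).trans (hB x)
  have hbi : ∀ (m : Measure X) [IsFiniteMeasure m] (f : X → ℝ) (hf : Measurable f) (C : ℝ)
      (_ : ∀ x, |f x| ≤ C), Integrable f m := fun m _ f hf C hC =>
    Integrable.of_bound hf.aestronglyMeasurable C (Eventually.of_forall hC)
  refine le_of_forall_pos_le_add fun ε hε => ?_
  have hsi : Integrable s (σ + μ) := hbi _ s hs B hB
  obtain ⟨δ, hδ, hδε⟩ : ∃ δ > 0, (1 + Real.exp B) * δ ≤ ε :=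
    ⟨ε / (1 + Real.exp B), by positivity, by field_simp; rfl⟩
  obtain ⟨g, hg, -⟩ := hsi.exists_boundedContinuous_integral_sub_le hδ
  let G : X →ᵇ ℝ := BoundedContinuousFunction.ofNormedAddCommGroup
    (fun x => max (-B) (min B (g x))) (by fun_prop) B (fun x => by
      rw [Real.norm_eq_abs, abs_le]
      exact ⟨le_max_left _ _, max_le (by linarith) (min_le_left _ _)⟩)
  have hG : ∀ x, G x = max (-B) (min B (g x)) := fun x => rfl
  have hGB : ∀ x, |G x| ≤ B := fun x => by
      rw [hG, abs_le]
      exact ⟨le_max_left _ _, max_le (by linarith) (min_le_left _ _)⟩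
  have hd : ∀ x, |s x - G x| ≤ |s x - g x| := by
    intro x
    have := abs_le.1 (hB x)
    rw [hG]
    rcases le_total B (g x) with h1 | h1
    · rw [min_eq_left h1, max_eq_right (by linarith)]
      rw [abs_of_nonpos (by linarith), abs_of_nonpos (by linarith)]; linarith
    · rw [min_eq_right h1]
      rcases le_total (-B) (g x) with h2 | h2
      · rw [max_eq_right h2]
      · rw [max_eq_left h2, abs_of_nonneg (by linarith), abs_of_nonneg (by linarith)]; linarith
  have he : ∀ x, |Real.exp (s x) - Real.exp (G x)| ≤ Real.exp B * |s x - G x| := by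
    have aux : ∀ a b : ℝ, a ≤ b → b ≤ B → Real.exp b - Real.exp a ≤ Real.exp B * (b - a) := by
      intro a b hab hbB
      have h1 := Real.add_one_le_exp (a - b)
      have h2 : Real.exp a = Real.exp b * Real.exp (a - b) := by rw [← Real.exp_add]; ring_nf
      have h3 : Real.exp b ≤ Real.exp B := Real.exp_le_exp.2 hbB
      have h4 := Real.exp_pos b
      nlinarith
    intro x
    have b1 := (abs_le.1 (hB x)).2
    have b2 := (abs_le.1 (hGB x)).2
    rcases le_total (s x) (G x) with h1 | h1
    · rw [abs_sub_comm, abs_sub_comm (s x), abs_of_nonneg (sub_nonneg.2 h1),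
        abs_of_nonneg (sub_nonneg.2 (Real.exp_le_exp.2 h1))]
      exact aux _ _ h1 b2
    · rw [abs_of_nonneg (sub_nonneg.2 h1), abs_of_nonneg (sub_nonneg.2 (Real.exp_le_exp.2 h1))]
      exact aux _ _ h1 b1
  have hms : ∀ (m : Measure X) [IsFiniteMeasure m], Integrable (fun x => |s x - G x|) m := by
    intro m _
    exact ((hbi m s hs B hB).sub (G.integrable m)).abs
  have hexp : ∀ t : X → ℝ, Measurable t → (∀ x, |t x| ≤ B) →
      Integrable (fun x => Real.exp (t x)) μ := fun t ht htB =>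
    hbi μ _ ht.exp (Real.exp B) (fun x => by
      rw [abs_of_pos (Real.exp_pos _)]; exact Real.exp_le_exp.2 (abs_le.1 (htB x)).2)
  have i1 : ∫ x, |s x - G x| ∂σ + ∫ x, |s x - G x| ∂μ ≤ δ := by
    rw [← integral_add_measure (hms σ) (hms μ)]
    refine le_trans ?_ hg
    exact integral_mono (hms _) (hsi.sub (g.integrable _)).norm hd
  have p1 : 0 ≤ ∫ x, |s x - G x| ∂σ := integral_nonneg fun x => abs_nonneg _
  have p2 : 0 ≤ ∫ x, |s x - G x| ∂μ := integral_nonneg fun x => abs_nonneg _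
  have i2 : ∫ x, s x ∂σ - ∫ x, G x ∂σ ≤ ∫ x, |s x - G x| ∂σ := by
    rw [← integral_sub (hbi σ s hs B hB) (G.integrable σ)]
    exact integral_mono ((hbi σ s hs B hB).sub (G.integrable σ)) (hms σ) fun x => le_abs_self _
  have eG := hexp G G.continuous.measurable hGB
  have es := hexp s hs hB
  have i3 : ∫ x, (Real.exp (G x) - 1) ∂μ - ∫ x, (Real.exp (s x) - 1) ∂μ
      ≤ Real.exp B * ∫ x, |s x - G x| ∂μ := by
    have eG1 : Integrable (fun x => Real.exp (G x) - 1) μ := eG.sub (integrable_const _)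
    have es1 : Integrable (fun x => Real.exp (s x) - 1) μ := es.sub (integrable_const _)
    rw [← integral_sub eG1 es1, ← integral_const_mul]
    refine integral_mono (eG1.sub es1)
      ((hms μ).const_mul _) fun x => ?_
    have := (abs_le.1 (he x)).1
    simp only
    linarith
  have := h G
  have hB' := Real.exp_pos B
  nlinarith

theorem kl_dual_ac {X : Type*} [MetricSpace X] [MeasurableSpace X] [BorelSpace X]
    (μ σ : Measure X) [IsProbabilityMeasure μ] [IsFiniteMeasure σ] (K : ℝ)
    (h : ∀ s : X →ᵇ ℝ, ∫ x, s x ∂σ - ∫ x, (Real.exp (s x) - 1) ∂μ ≤ K) : σ ≪ μ := by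
  refine Measure.AbsolutelyContinuous.mk fun A hA hμA => ?_
  by_contra hne
  have hpos : 0 < σ.real A := ENNReal.toReal_pos hne (measure_ne_top _ _)
  obtain ⟨N, hN⟩ := exists_nat_gt (K / σ.real A)
  rw [div_lt_iff₀ hpos] at hN
  have := kl_dual_meas μ σ K h (A.indicator fun _ => (N : ℝ)) (measurable_const.indicator hA) N
    (fun x => by
      by_cases hx : x ∈ A <;> simp [hx])
  rw [integral_indicator hA] at this
  have h0 : ∫ x, (Real.exp (A.indicator (fun _ => (N : ℝ)) x) - 1) ∂μ = 0 := by
    rw [integral_eq_zero_of_ae]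
    have : ∀ᵐ x ∂μ, x ∉ A := measure_eq_zero_iff_ae_notMem.1 hμA
    filter_upwards [this] with x hx
    simp [hx]
  rw [h0] at this
  simp at this
  linarith

theorem clip_nonneg (r : ℝ) (n : ℕ) (hr : 0 ≤ r) :
    0 ≤ r * Real.log (max (1 / ((n:ℝ) + 1)) (min r (n + 1))) - max (1 / ((n:ℝ) + 1)) (min r (n + 1)) + 1 := by
  have hn : (0 : ℝ) < n + 1 := by positivity
  have h1n : (1 : ℝ) ≤ n + 1 := by linarith [(Nat.cast_nonneg n : (0:ℝ) ≤ n)]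
  have h2n : 1 / ((n:ℝ) + 1) ≤ 1 := by rw [div_le_one hn]; exact h1n
  have hk : ∀ q : ℝ, 0 ≤ q → 0 ≤ q * Real.log q - q + 1 := fun q hq => by
    have := InformationTheory.klFun_nonneg hq
    rw [InformationTheory.klFun_apply] at this; linarith
  rcases le_total r (n + 1) with h1 | h1
  · rw [min_eq_left h1]
    rcases le_total (1 / ((n:ℝ) + 1)) r with h2 | h2
    · rw [max_eq_right h2]; exact hk r hr
    · rw [max_eq_left h2]
      have := hk (1 / ((n:ℝ) + 1)) (by positivity)
      have hl := Real.log_nonpos (by positivity) h2n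
      nlinarith
  · rw [min_eq_right h1, max_eq_right (by linarith)]
    have := hk (n + 1) hn.le
    have hl := Real.log_nonneg h1n
    nlinarith

theorem clip_tendsto (r : ℝ) (hr : 0 ≤ r) :
    Tendsto (fun n : ℕ => r * Real.log (max (1 / ((n:ℝ) + 1)) (min r (n + 1)))
      - max (1 / ((n:ℝ) + 1)) (min r (n + 1)) + 1) atTop (𝓝 (r * Real.log r - r + 1)) := by
  have hq : Tendsto (fun n : ℕ => max (1 / ((n:ℝ) + 1)) (min r (n + 1))) atTop (𝓝 r) := by
    have h1 : Tendsto (fun n : ℕ => 1 / ((n:ℝ) + 1)) atTop (𝓝 0) :=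
      tendsto_one_div_add_atTop_nhds_zero_nat
    have h2 : Tendsto (fun n : ℕ => min r ((n:ℝ) + 1)) atTop (𝓝 r) := by
      obtain ⟨N, hN⟩ := exists_nat_gt r
      refine tendsto_const_nhds.congr' ?_
      filter_upwards [eventually_ge_atTop N] with n hn
      have : (N : ℝ) ≤ n := by exact_mod_cast hn
      rw [min_eq_left (by linarith)]
    have := h1.max h2
    rwa [max_eq_right hr] at this
  rcases hr.eq_or_lt with h0 | h0
  · subst h0
    simpa using (hq.const_sub 0).add_const 1
  · exact ((((Real.continuousAt_log h0.ne').tendsto.comp hq).const_mul r).sub hq).add_const 1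

theorem kl_dual {X : Type*} [MetricSpace X] [MeasurableSpace X] [BorelSpace X]
    (μ σ : Measure X) [IsProbabilityMeasure μ] [IsFiniteMeasure σ] (K : ℝ)
    (h : ∀ s : X →ᵇ ℝ, ∫ x, s x ∂σ - ∫ x, (Real.exp (s x) - 1) ∂μ ≤ K) :
    divergenceF Fkl σ μ ≤ ENNReal.ofReal K := by
  have hac := kl_dual_ac μ σ K h
  rw [divergenceF, if_pos hac]
  set r : X → ℝ := fun x => (σ.rnDeriv μ x).toReal with hr
  have hrm : Measurable r := (Measure.measurable_rnDeriv σ μ).ennreal_toReal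
  have hr0 : ∀ x, 0 ≤ r x := fun x => ENNReal.toReal_nonneg
  let q : ℕ → X → ℝ := fun n x => max (1 / ((n:ℝ) + 1)) (min (r x) (n + 1))
  have hqm : ∀ n, Measurable (q n) := fun n => by
    exact measurable_const.max (hrm.min measurable_const)
  let f : ℕ → X → ℝ := fun n x => r x * Real.log (q n x) - q n x + 1
  have hfm : ∀ n, Measurable (f n) := fun n =>
    ((hrm.mul (hqm n).log).sub (hqm n)).add_const 1
  have hF : ∀ᵐ x ∂μ, Fkl (σ.rnDeriv μ x) =
      liminf (fun n => ENNReal.ofReal (f n x)) atTop := by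
    filter_upwards [Measure.rnDeriv_lt_top σ μ] with x hx
    rw [Fkl, if_neg hx.ne]
    refine (Tendsto.liminf_eq ?_).symm
    exact (ENNReal.continuous_ofReal.tendsto _).comp (clip_tendsto (r x) (hr0 x))
  rw [lintegral_congr_ae hF]
  refine (lintegral_liminf_le fun n => (hfm n).ennreal_ofReal).trans ?_
  refine liminf_le_of_le (by isBoundedDefault) ?_
  intro b hb
  obtain ⟨n, hn⟩ := hb.exists
  refine hn.trans ?_
  have hn0 : (0 : ℝ) < n + 1 := by positivity
  have hq1 : ∀ x, 1 / ((n:ℝ) + 1) ≤ q n x := fun x => le_max_left _ _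
  have hq2 : ∀ x, q n x ≤ n + 1 := fun x => max_le (by
    rw [div_le_iff₀ hn0]; nlinarith [(Nat.cast_nonneg n : (0:ℝ) ≤ n)]) (min_le_right _ _)
  have hq0 : ∀ x, 0 < q n x := fun x => lt_of_lt_of_le (by positivity) (hq1 x)
  have hlog : ∀ x, |Real.log (q n x)| ≤ Real.log (n + 1) := by
    intro x
    rw [abs_le]
    constructor
    · have := Real.log_le_log (by positivity) (hq1 x)
      rwa [one_div, Real.log_inv] at this
    · exact Real.log_le_log (hq0 x) (hq2 x)
  have key := kl_dual_meas μ σ K h (fun x => Real.log (q n x)) (hqm n).log _ hlog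
  have hri : Integrable (fun x => r x * Real.log (q n x)) μ := by
    refine Integrable.mul_bdd (c := Real.log (n+1)) Measure.integrable_toReal_rnDeriv
      (hqm n).log.aestronglyMeasurable (Eventually.of_forall hlog)
  have hqi : Integrable (q n) μ := Integrable.of_bound (hqm n).aestronglyMeasurable (n+1)
    (Eventually.of_forall fun x => by rw [Real.norm_eq_abs, abs_of_pos (hq0 x)]; exact hq2 x)
  have hfi : Integrable (f n) μ := (hri.sub hqi).add (integrable_const 1)
  rw [← ofReal_integral_eq_lintegral_ofReal hfi
    (Eventually.of_forall fun x => clip_nonneg _ n (hr0 x))]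
  refine ENNReal.ofReal_le_ofReal (le_trans (le_of_eq ?_) key)
  have e1 : ∫ x, Real.log (q n x) ∂σ = ∫ x, r x * Real.log (q n x) ∂μ := by
    rw [← integral_rnDeriv_smul hac]; rfl
  rw [e1]
  simp_rw [fun x => Real.exp_log (hq0 x)]
  have hq1i : Integrable (fun x => q n x - 1) μ := hqi.sub (integrable_const 1)
  rw [← integral_sub hri hq1i]
  refine integral_congr_ae (Eventually.of_forall fun x => ?_)
  simp [f]; ring

theorem lsc_approx {Z : Type*} [MetricSpace Z] [MeasurableSpace Z] [BorelSpace Z]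
    (γ : Measure Z) [IsFiniteMeasure γ] (c : Z → ℝ≥0∞) (hc : LowerSemicontinuous c) (K : ℝ)
    (h : ∀ φ : Z →ᵇ ℝ, (∀ z, ENNReal.ofReal (φ z) ≤ c z) → ∫ z, φ z ∂γ ≤ K) :
    ∫⁻ z, c z ∂γ ≤ ENNReal.ofReal K := by
  let f : ℕ → Z → ℝ≥0∞ := fun n z => ⨅ w, (min (c w) n + n * edist z w)
  have hfc : ∀ n z, f n z ≤ min (c z) n := fun n z => (iInf_le _ z).trans (by simp)
  have hfn : ∀ n z, f n z ≤ n := fun n z => (hfc n z).trans (min_le_right _ _)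
  have hft : ∀ n z, f n z ≠ ⊤ := fun n z => ne_top_of_le_ne_top (ENNReal.natCast_ne_top n) (hfn n z)
  have hmono : Monotone f := by
    intro m n hmn z
    have : (m : ℝ≥0∞) ≤ n := by exact_mod_cast hmn
    exact iInf_mono fun w => by gcongr
  have hlip : ∀ n z z', f n z ≤ f n z' + n * edist z z' := by
    intro n z z'
    rw [ENNReal.iInf_add]
    refine le_iInf fun w => (iInf_le _ w).trans ?_
    rw [add_assoc, ← mul_add]
    gcongr
    rw [add_comm]
    exact edist_triangle _ _ _
  have hcont : ∀ n, Continuous fun z => (f n z).toReal := by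
    intro n
    refine (LipschitzWith.of_le_add_mul (n : ℝ≥0) fun z z' => ?_).continuous
    have := ENNReal.toReal_mono (by finiteness [hft n z', edist_ne_top z z']) (hlip n z z')
    rw [ENNReal.toReal_add (hft n z') (by finiteness [edist_ne_top z z']), ENNReal.toReal_mul] at this
    simpa [dist_edist] using this
  have hsup : ∀ z, c z = ⨆ n, f n z := by
    intro z
    refine le_antisymm (le_of_forall_lt fun a ha => ?_) (iSup_le fun n => (hfc n z).trans (min_le_left _ _))
    obtain ⟨b, hab, hb⟩ := exists_between ha
    refine hab.trans_le ?_
    have hbt : b ≠ ⊤ := hb.ne_top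
    obtain ⟨δ, hδ, hball⟩ := EMetric.mem_nhds_iff.1 (hc z b hb)
    obtain ⟨n1, hn1⟩ := ENNReal.exists_nat_gt hbt
    obtain ⟨n2, hn2⟩ := ENNReal.exists_nat_mul_gt hδ.ne' hbt
    refine le_iSup_of_le (max n1 n2) (le_iInf fun w => ?_)
    have k1 : (n1 : ℝ≥0∞) ≤ (max n1 n2 : ℕ) := by exact_mod_cast le_max_left _ _
    have k2 : (n2 : ℝ≥0∞) ≤ (max n1 n2 : ℕ) := by exact_mod_cast le_max_right _ _
    by_cases hw : edist w z < δ
    · refine le_add_right (le_min (hball hw).le (hn1.le.trans k1))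
    · refine le_add_left (hn2.le.trans ?_)
      rw [edist_comm]
      exact mul_le_mul' k2 (not_lt.1 hw)
  have hfm : ∀ n, Measurable (f n) := by
    intro n
    have : f n = fun z => ENNReal.ofReal (f n z).toReal := by
      ext z; rw [ENNReal.ofReal_toReal (hft n z)]
    rw [this]; exact (hcont n).measurable.ennreal_ofReal
  simp_rw [hsup]
  rw [lintegral_iSup hfm hmono]
  refine iSup_le fun n => ?_
  let φ : Z →ᵇ ℝ := BoundedContinuousFunction.ofNormedAddCommGroup (fun z => (f n z).toReal)
    (hcont n) n (fun z => by
      rw [Real.norm_eq_abs, abs_of_nonneg ENNReal.toReal_nonneg]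
      exact ENNReal.toReal_le_of_le_ofReal (by positivity) (by simpa using hfn n z))
  have hφ : ∀ z, ENNReal.ofReal (φ z) = f n z := fun z => ENNReal.ofReal_toReal (hft n z)
  have := h φ (fun z => by rw [hφ]; exact (hfc n z).trans (min_le_left _ _))
  refine le_trans (le_of_eq ?_) (ENNReal.ofReal_le_ofReal this)
  rw [ofReal_integral_eq_lintegral_ofReal (φ.integrable γ)
    (Eventually.of_forall fun z => ENNReal.toReal_nonneg)]
  simp_rw [hφ]

noncomputable def JJ {X : Type*} [MeasurableSpace X] (Λ : ℝ) (μ : Measure X) (u : X → ℝ) : ℝ :=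
  ∫ x, Λ * (1 - Real.exp (-(u x) / Λ)) ∂μ

lemma JJ_exp_int {X : Type*} [TopologicalSpace X] [MeasurableSpace X] [BorelSpace X] (Λ : ℝ)
    (hΛ : 0 < Λ) (μ : Measure X) [IsFiniteMeasure μ] (u : X →ᵇ ℝ) :
    Integrable (fun x => Real.exp (-(u x) / Λ)) μ := by
  refine Integrable.of_bound (by
    have : Continuous fun x => Real.exp (-(u x) / Λ) := by fun_prop
    exact this.measurable.aestronglyMeasurable) (Real.exp (‖u‖ / Λ)) (Eventually.of_forall fun x => ?_)
  rw [Real.norm_eq_abs, abs_of_pos (Real.exp_pos _)]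
  refine Real.exp_le_exp.2 (div_le_div_of_nonneg_right ?_ hΛ.le)
  have := u.norm_coe_le_norm x
  rw [Real.norm_eq_abs] at this
  linarith [neg_abs_le (u x)]

lemma JJ_int {X : Type*} [TopologicalSpace X] [MeasurableSpace X] [BorelSpace X] (Λ : ℝ)
    (hΛ : 0 < Λ) (μ : Measure X) [IsFiniteMeasure μ] (u : X →ᵇ ℝ) :
    Integrable (fun x => Λ * (1 - Real.exp (-(u x) / Λ))) μ :=
  ((integrable_const 1).sub (JJ_exp_int Λ hΛ μ u)).const_mul Λ

lemma JJ_zero {X : Type*} [TopologicalSpace X] [MeasurableSpace X] (Λ : ℝ) (μ : Measure X) :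
    JJ Λ μ (0 : X →ᵇ ℝ) = 0 := by simp [JJ]

lemma JJ_concave {X : Type*} [TopologicalSpace X] [MeasurableSpace X] [BorelSpace X] (Λ : ℝ)
    (hΛ : 0 < Λ) (μ : Measure X) [IsFiniteMeasure μ] (u v : X →ᵇ ℝ) (a b : ℝ) (ha : 0 ≤ a)
    (hb : 0 ≤ b) (hab : a + b = 1) :
    a * JJ Λ μ u + b * JJ Λ μ v ≤ JJ Λ μ (a • u + b • v : X →ᵇ ℝ) := by
  unfold JJ
  rw [← integral_const_mul, ← integral_const_mul,
    ← integral_add ((JJ_int Λ hΛ μ u).const_mul a) ((JJ_int Λ hΛ μ v).const_mul b)]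
  refine integral_mono (((JJ_int Λ hΛ μ u).const_mul a).add ((JJ_int Λ hΛ μ v).const_mul b))
    (JJ_int Λ hΛ μ _) fun x => ?_
  have := convexOn_exp.2 (Set.mem_univ (-(u x) / Λ)) (Set.mem_univ (-(v x) / Λ)) ha hb hab
  simp only [smul_eq_mul] at this
  have e : -((a • u + b • v : X →ᵇ ℝ) x) / Λ = a * (-(u x) / Λ) + b * (-(v x) / Λ) := by
    simp; ring
  simp only [e]
  have hb' : b = 1 - a := by linarith
  have := mul_le_mul_of_nonneg_left this hΛ.le
  calc _ = Λ * 1 - Λ * (a * Real.exp (-(u x) / Λ) + b * Real.exp (-(v x) / Λ)) := by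
        rw [hb']; ring
    _ ≤ _ := by rw [mul_sub]; linarith

theorem hahn_banach_dual {X : Type*} [MetricSpace X] [MeasurableSpace X] [BorelSpace X]
    (c : X × X → ℝ≥0∞) (Λ : ℝ) (hΛ : 0 < Λ) (μ ν : Measure X)
    [IsProbabilityMeasure μ] [IsProbabilityMeasure ν] (M : ℝ)
    (hM : ∀ u v : X →ᵇ ℝ, (∀ x y, ENNReal.ofReal (u x + v y) ≤ c (x, y)) →
      JJ Λ μ u + JJ Λ ν v ≤ M) :
    ∃ l : (X × X →ᵇ ℝ) →ₗ[ℝ] ℝ, (∀ f : X × X →ᵇ ℝ, (∀ z, 0 ≤ f z) → 0 ≤ l f) ∧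
      ∀ (u v : X →ᵇ ℝ) (ψ : X × X →ᵇ ℝ),
        (∀ x y, ENNReal.ofReal (u x + v y + ψ (x, y)) ≤ c (x, y)) →
        JJ Λ μ u + JJ Λ ν v + l ψ ≤ M := by
  let S : Set ((X × X →ᵇ ℝ) × ℝ) := {p | ∃ (u v : X →ᵇ ℝ) (ε : ℝ), 0 < ε ∧
    (∀ x y, ENNReal.ofReal (u x + v y + p.1 (x, y) + ε) ≤ c (x, y)) ∧
    p.2 < JJ Λ μ u + JJ Λ ν v}
  have hopen : IsOpen S := by
    rw [Metric.isOpen_iff]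
    rintro ⟨ψ, t⟩ ⟨u, v, ε, hε, h1, h2⟩
    refine ⟨min (ε / 2) (JJ Λ μ u + JJ Λ ν v - t), lt_min (by positivity) (by simpa using h2), ?_⟩
    rintro ⟨ψ', t'⟩ hp
    rw [Metric.mem_ball, lt_min_iff, Prod.dist_eq] at hp
    have d1 := (le_max_left _ _).trans_lt hp.1
    have d2 := (le_max_right _ _).trans_lt hp.2
    simp only at d1 d2 h1 h2
    refine ⟨u, v, ε / 2, by positivity, fun x y => le_trans (ENNReal.ofReal_le_ofReal ?_) (h1 x y), ?_⟩
    · have := (BoundedContinuousFunction.dist_coe_le_dist (f := ψ') (g := ψ) (x, y)).trans_lt d1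
      rw [Real.dist_eq, abs_lt] at this
      simp only
      linarith
    · rw [Real.dist_eq, abs_lt] at d2
      simp only
      linarith
  have hconv : Convex ℝ S := by
    rintro ⟨ψ, t⟩ ⟨u, v, ε, hε, h1, h2⟩ ⟨ψ', t'⟩ ⟨u', v', ε', hε', h1', h2'⟩ a b ha hb hab
    refine ⟨a • u + b • u', a • v + b • v', a * ε + b * ε', ?_, fun x y => ?_, ?_⟩
    · rcases ha.eq_or_lt with h | h
      · have : b = 1 := by linarith
        subst this; subst h; simpa using hε'
      · have : 0 ≤ b * ε' := by positivity
        have : 0 < a * ε := by positivity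
        linarith
    · have e : (a • u + b • u' : X →ᵇ ℝ) x + (a • v + b • v' : X →ᵇ ℝ) y
          + (a • (ψ, t) + b • (ψ', t')).1 (x, y) + (a * ε + b * ε')
          = a * (u x + v y + ψ (x, y) + ε) + b * (u' x + v' y + ψ' (x, y) + ε') := by
        simp; ring
      rw [e]
      refine ENNReal.ofReal_add_le.trans ?_
      rw [ENNReal.ofReal_mul ha, ENNReal.ofReal_mul hb]
      refine (add_le_add (mul_le_mul_right (h1 x y) _) (mul_le_mul_right (h1' x y) _)).trans ?_
      rw [← add_mul, ← ENNReal.ofReal_add ha hb, hab]; simp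
    · have k1 := JJ_concave Λ hΛ μ u u' a b ha hb hab
      have k2 := JJ_concave Λ hΛ ν v v' a b ha hb hab
      simp only at h2 h2'
      have : a * t + b * t' < a * (JJ Λ μ u + JJ Λ ν v) + b * (JJ Λ μ u' + JJ Λ ν v') := by
        rcases ha.eq_or_lt with h | h
        · have : b = 1 := by linarith
          subst this; subst h; simpa using h2'
        · have := mul_lt_mul_of_pos_left h2 h
          have := mul_le_mul_of_nonneg_left h2'.le hb
          linarith
      simp only [Prod.smul_mk, Prod.mk_add_mk, smul_eq_mul]
      linarith
  have hnot : ((0 : X × X →ᵇ ℝ), M) ∉ S := by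
    rintro ⟨u, v, ε, hε, h1, h2⟩
    refine absurd (hM u v fun x y => le_trans (ENNReal.ofReal_le_ofReal ?_) (h1 x y)) (not_le.2 h2)
    simp only [BoundedContinuousFunction.coe_zero, Pi.zero_apply]
    linarith
  obtain ⟨f, hf⟩ := geometric_hahn_banach_open_point hconv hopen hnot
  let g : (X × X →ᵇ ℝ) →ₗ[ℝ] ℝ := f.toLinearMap.comp (LinearMap.inl ℝ _ _)
  let s : ℝ := f (0, 1)
  have hfs : ∀ ψ t, f (ψ, t) = g ψ + t * s := by
    intro ψ t
    have : (ψ, t) = (ψ, (0:ℝ)) + t • ((0 : X × X →ᵇ ℝ), (1 : ℝ)) := by simp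
    rw [this, map_add, map_smul]; rfl
  have hf' : ∀ ψ t, (ψ, t) ∈ S → g ψ + t * s < M * s := by
    intro ψ t h
    have := hf _ h
    rw [hfs, hfs, map_zero, zero_add] at this
    exact this
  -- base point
  let w : X →ᵇ ℝ := BoundedContinuousFunction.const X (-1)
  let t0 : ℝ := JJ Λ μ w + JJ Λ ν w - 1
  have hbase : ∀ ψ : X × X →ᵇ ℝ, (∀ z, ψ z ≤ 0) → (ψ, t0) ∈ S := by
    intro ψ hψ
    refine ⟨w, w, 1, one_pos, fun x y => ?_, by simp [t0]⟩
    rw [ENNReal.ofReal_of_nonpos]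
    · simp
    · have := hψ (x, y)
      simp [w]; linarith
  have ht0M : t0 < M := by
    have := hM w w (fun x y => by rw [ENNReal.ofReal_of_nonpos]; · simp
                                  · simp [w])
    simp only [t0]; linarith
  have hs : 0 < s := by
    have := hf' 0 t0 (hbase 0 (fun z => le_rfl))
    rw [map_zero, zero_add] at this
    by_contra hn
    nlinarith
  refine ⟨s⁻¹ • g, fun φ hφ => ?_, fun u v ψ h => ?_⟩
  · rw [LinearMap.smul_apply, smul_eq_mul]
    refine mul_nonneg (by positivity) ?_
    by_contra hn
    push Not at hn
    obtain ⟨n, hn'⟩ := exists_nat_gt ((M - t0) * s / (-g φ))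
    rw [div_lt_iff₀ (by linarith)] at hn'
    have := hf' (-((n:ℝ) • φ)) t0 (hbase _ fun z => by
      have := hφ z
      simp; positivity)
    rw [map_neg, map_smul, smul_eq_mul] at this
    nlinarith
  · rw [LinearMap.smul_apply, smul_eq_mul]
    have key : ∀ ε > 0, g ψ + (JJ Λ μ u + JJ Λ ν v) * s ≤ M * s + ε * (g 1 + s) := by
      intro ε hε
      have := hf' (ψ - ε • 1) (JJ Λ μ u + JJ Λ ν v - ε) ⟨u, v, ε, hε, fun x y => by
        have e : u x + v y + (ψ - ε • 1 : X × X →ᵇ ℝ) (x, y) + ε = u x + v y + ψ (x, y) := by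
          simp; ring
        simp only [e]
        exact h x y, by simpa using hε⟩
      rw [map_sub, map_smul, smul_eq_mul] at this
      linarith
    have key2 : g ψ + (JJ Λ μ u + JJ Λ ν v) * s ≤ M * s := by
      have ht : Tendsto (fun ε : ℝ => M * s + ε * (g 1 + s)) (𝓝[>] 0) (𝓝 (M * s)) := by
        have : Continuous fun ε : ℝ => M * s + ε * (g 1 + s) := by fun_prop
        have := this.tendsto 0
        simp only [zero_mul, add_zero] at this
        exact this.mono_left nhdsWithin_le_nhds
      exact ge_of_tendsto ht (by filter_upwards [self_mem_nhdsWithin] with ε hε using key ε hε)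
    have := mul_le_mul_of_nonneg_left key2 (inv_nonneg.2 hs.le)
    field_simp at this ⊢
    linarith

theorem ereal_le_iff (t : ℝ) (c : ℝ≥0∞) : ((t : ℝ) : EReal) ≤ (c : EReal) ↔ ENNReal.ofReal t ≤ c := by
  induction c with
  | top => simp
  | coe r =>
    rw [ENNReal.ofReal_le_iff_le_toReal ENNReal.coe_ne_top]
    change (t : EReal) ≤ ((r : ℝ) : EReal) ↔ t ≤ (r : ℝ)
    exact EReal.coe_le_coe_iff

theorem young_real (r s : ℝ) (hr : 0 ≤ r) :
    r * s + 1 ≤ (r * Real.log r - r + 1) + Real.exp s := by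
  rcases hr.eq_or_lt with h | h
  · subst h; simp [Real.exp_nonneg]
  · have h1 := Real.add_one_le_exp (s - Real.log r)
    have h2 : Real.exp s = r * Real.exp (s - Real.log r) := by
      rw [Real.exp_sub, Real.exp_log h]; field_simp
    rw [h2]; nlinarith

theorem young_ennreal (Λ : ℝ) (hΛ : 0 < Λ) (r : ℝ≥0∞) (hr : r ≠ ⊤) (u : ℝ) :
    ENNReal.ofReal Λ + r * ENNReal.ofReal (-u) ≤
      ENNReal.ofReal Λ * Fkl r + ENNReal.ofReal (Λ * Real.exp (-u / Λ)) + r * ENNReal.ofReal u := by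
  lift r to ℝ≥0 using hr
  have hk : 0 ≤ (r:ℝ) * Real.log r - r + 1 := by
    have := InformationTheory.klFun_nonneg r.2
    rw [InformationTheory.klFun_apply] at this
    change 0 ≤ (r:ℝ) * Real.log r + 1 - r at this
    linarith
  have hy := mul_le_mul_of_nonneg_left (young_real r (-u / Λ) r.2) hΛ.le
  have e : Λ * ((r:ℝ) * (-u / Λ) + 1) = r * (-u) + Λ := by field_simp
  rw [e] at hy
  have hr0 : (0:ℝ) ≤ r := r.2
  rw [Fkl, if_neg ENNReal.coe_ne_top, ENNReal.coe_toReal, ← ENNReal.ofReal_coe_nnreal,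
    ← ENNReal.ofReal_mul hΛ.le, ← ENNReal.ofReal_mul hr0, ← ENNReal.ofReal_mul hr0]
  have hE := Real.exp_pos (-u / Λ)
  rcases le_total u 0 with h | h
  · rw [← ENNReal.ofReal_add hΛ.le (mul_nonneg hr0 (by linarith : (0:ℝ) ≤ -u)),
      ← ENNReal.ofReal_add (by positivity) (by positivity)]
    refine le_add_right (ENNReal.ofReal_le_ofReal ?_)
    linarith
  · rw [ENNReal.ofReal_of_nonpos (p := r * (-u)) (by nlinarith [r.2]), add_zero,
      ← ENNReal.ofReal_add (by positivity) (by positivity),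
      ← ENNReal.ofReal_add (by positivity) (by positivity)]
    refine ENNReal.ofReal_le_ofReal ?_
    linarith

theorem young_ennreal' (Λ : ℝ) (hΛ : 0 < Λ) (r : ℝ≥0∞) (hr : r ≠ ⊤) (u : ℝ) :
    r * ENNReal.ofReal (-u) ≤
      ENNReal.ofReal Λ * Fkl r + ENNReal.ofReal (Λ * Real.exp (-u / Λ)) := by
  rcases le_total u 0 with h | h
  · have := young_ennreal Λ hΛ r hr u
    rw [ENNReal.ofReal_of_nonpos h, mul_zero, add_zero] at this
    exact le_trans le_add_self this
  · rw [ENNReal.ofReal_of_nonpos (by linarith : -u ≤ 0)]; simp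

theorem measurable_Fkl : Measurable Fkl := by
  unfold Fkl
  refine Measurable.ite (measurableSet_singleton _) measurable_const ?_
  have h := ENNReal.measurable_toReal
  exact (((h.mul h.log).sub h).add_const 1).ennreal_ofReal

theorem marg_weak {X : Type*} [MeasurableSpace X] (Λ : ℝ) (hΛ : 0 < Λ)
    (μ σ : Measure X) [IsProbabilityMeasure μ] [IsFiniteMeasure σ] (hac : σ ≪ μ)
    (u : X → ℝ) (hu : Measurable u) :
    (ENNReal.ofReal Λ + ∫⁻ x, ENNReal.ofReal (-u x) ∂σ ≤
      ENNReal.ofReal Λ * divergenceF Fkl σ μ + ∫⁻ x, ENNReal.ofReal (Λ * Real.exp (-(u x) / Λ)) ∂μ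
        + ∫⁻ x, ENNReal.ofReal (u x) ∂σ) ∧
    (∫⁻ x, ENNReal.ofReal (-u x) ∂σ ≤
      ENNReal.ofReal Λ * divergenceF Fkl σ μ
        + ∫⁻ x, ENNReal.ofReal (Λ * Real.exp (-(u x) / Λ)) ∂μ) := by
  have m1 : Measurable fun x => ENNReal.ofReal (-u x) := hu.neg.ennreal_ofReal
  have m2 : Measurable fun x => ENNReal.ofReal (u x) := hu.ennreal_ofReal
  have m3 : Measurable fun x => ENNReal.ofReal (Λ * Real.exp (-(u x) / Λ)) :=
    ((hu.neg.div_const Λ).exp.const_mul Λ).ennreal_ofReal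
  have mr := Measure.measurable_rnDeriv σ μ
  have m4 : Measurable fun x => ENNReal.ofReal Λ * Fkl (σ.rnDeriv μ x) :=
    (measurable_Fkl.comp mr).const_mul _
  have m6 : Measurable fun x => σ.rnDeriv μ x * ENNReal.ofReal (u x) := mr.mul m2
  have m5 : Measurable fun x => Fkl (σ.rnDeriv μ x) := measurable_Fkl.comp mr
  rw [divergenceF, if_pos hac, ← lintegral_rnDeriv_mul hac m1.aemeasurable,
    ← lintegral_rnDeriv_mul hac m2.aemeasurable,
    ← lintegral_const_mul _ m5]
  have hlt := Measure.rnDeriv_lt_top σ μ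
  constructor
  · have : ENNReal.ofReal Λ = ∫⁻ _, ENNReal.ofReal Λ ∂μ := by simp
    rw [← lintegral_add_left m4, ← lintegral_add_right _ m6]
    nth_rewrite 1 [this]
    rw [← lintegral_add_left measurable_const]
    refine lintegral_mono_ae ?_
    filter_upwards [hlt] with x hx
    exact young_ennreal Λ hΛ _ hx.ne _
  · rw [← lintegral_add_left m4]
    refine lintegral_mono_ae ?_
    filter_upwards [hlt] with x hx
    exact young_ennreal' Λ hΛ _ hx.ne _

theorem weak_duality {d : ℕ}
    (c : EuclideanSpace ℝ (Fin d) × EuclideanSpace ℝ (Fin d) → ℝ≥0∞)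
    (Λ : ℝ) (hΛ : 0 < Λ)
    (μ ν : Measure (EuclideanSpace ℝ (Fin d)))
    [IsProbabilityMeasure μ] [IsProbabilityMeasure ν]
    (γ : Measure (EuclideanSpace ℝ (Fin d) × EuclideanSpace ℝ (Fin d))) [IsFiniteMeasure γ]
    (u v : EuclideanSpace ℝ (Fin d) → ℝ) (hu : Continuous u) (hv : Continuous v)
    (h : ∀ x y, ((u x + v y : ℝ) : EReal) ≤ ((c (x, y) : ℝ≥0∞) : EReal)) :
    dualKL Λ μ ν u v ≤ ((ETKL c Λ μ ν γ : ℝ≥0∞) : EReal) := by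
  rw [dualKL]
  set A := ∫⁻ x, ENNReal.ofReal (Λ * Real.exp (-(u x) / Λ)) ∂μ with hA
  set B := ∫⁻ x, ENNReal.ofReal (Λ * Real.exp (-(v x) / Λ)) ∂ν with hB
  by_cases hAt : A = ⊤
  · rw [hAt]; simp
  by_cases hBt : B = ⊤
  · rw [hBt]; simp
  by_cases hEt : ETKL c Λ μ ν γ = ⊤
  · rw [hEt]; simp
  have key : ENNReal.ofReal Λ + ENNReal.ofReal Λ ≤ ETKL c Λ μ ν γ + A + B := by
    rw [ETKL] at hEt ⊢
    set C := ∫⁻ p, c p ∂γ with hC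
    have hE1 := (ENNReal.add_ne_top.1 hEt).2
    have hE2 := (ENNReal.add_ne_top.1 (ENNReal.add_ne_top.1 hEt).1).2
    have hE3 := (ENNReal.add_ne_top.1 (ENNReal.add_ne_top.1 hEt).1).1
    have hL : ENNReal.ofReal Λ ≠ 0 := by simpa using hΛ
    have ac1 : γ.map Prod.fst ≪ μ := by
      by_contra hn
      rw [divergenceF, if_neg hn, ENNReal.mul_top hL] at hE2
      exact hE2 rfl
    have ac2 : γ.map Prod.snd ≪ ν := by
      by_contra hn
      rw [divergenceF, if_neg hn, ENNReal.mul_top hL] at hE1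
      exact hE1 rfl
    obtain ⟨a1, a2⟩ := marg_weak Λ hΛ μ _ ac1 u hu.measurable
    obtain ⟨b1, b2⟩ := marg_weak Λ hΛ ν _ ac2 v hv.measurable
    have mu := hu.measurable
    have mv := hv.measurable
    have mu' : Measurable fun x => ENNReal.ofReal (-u x) := mu.neg.ennreal_ofReal
    have mv' : Measurable fun x => ENNReal.ofReal (-v x) := mv.neg.ennreal_ofReal
    rw [lintegral_map mu' measurable_fst] at a1 a2
    rw [lintegral_map mu.ennreal_ofReal measurable_fst] at a1
    rw [lintegral_map mv' measurable_snd] at b1 b2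
    rw [lintegral_map mv.ennreal_ofReal measurable_snd] at b1
    rw [← hA] at a1 a2
    rw [← hB] at b1 b2
    set K1 := ENNReal.ofReal Λ * divergenceF Fkl (γ.map Prod.fst) μ
    set K2 := ENNReal.ofReal Λ * divergenceF Fkl (γ.map Prod.snd) ν
    set P1 := ∫⁻ p, ENNReal.ofReal (-u (Prod.fst p)) ∂γ
    set P2 := ∫⁻ p, ENNReal.ofReal (-v (Prod.snd p)) ∂γ
    set Q1 := ∫⁻ p, ENNReal.ofReal (u (Prod.fst p)) ∂γ with hQ1
    set Q2 := ∫⁻ p, ENNReal.ofReal (v (Prod.snd p)) ∂γ with hQ2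
    have hP1 : P1 ≠ ⊤ := ne_top_of_le_ne_top (ENNReal.add_ne_top.2 ⟨hE2, hAt⟩) a2
    have hP2 : P2 ≠ ⊤ := ne_top_of_le_ne_top (ENNReal.add_ne_top.2 ⟨hE1, hBt⟩) b2
    have hQ : Q1 + Q2 ≤ C + P1 + P2 := by
      have m1 : Measurable fun p : EuclideanSpace ℝ (Fin d) × EuclideanSpace ℝ (Fin d) =>
        ENNReal.ofReal (u p.1) := (mu.comp measurable_fst).ennreal_ofReal
      have m2 : Measurable fun p : EuclideanSpace ℝ (Fin d) × EuclideanSpace ℝ (Fin d) =>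
        ENNReal.ofReal (-u p.1) := (mu.comp measurable_fst).neg.ennreal_ofReal
      have m3 : Measurable fun p : EuclideanSpace ℝ (Fin d) × EuclideanSpace ℝ (Fin d) =>
        ENNReal.ofReal (-v p.2) := (mv.comp measurable_snd).neg.ennreal_ofReal
      rw [hQ1, hQ2, ← lintegral_add_left m1, hC, ← lintegral_add_right _ m2,
        ← lintegral_add_right _ m3]
      refine lintegral_mono fun p => ?_
      have := (ereal_le_iff _ _).1 (h p.1 p.2)
      refine le_trans ?_ (add_le_add_left (add_le_add_left this _) _)
      rcases le_total (u p.1) 0 with h1 | h1 <;> rcases le_total (v p.2) 0 with h2 | h2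
      · rw [ENNReal.ofReal_of_nonpos h1, ENNReal.ofReal_of_nonpos h2]; simp
      · rw [ENNReal.ofReal_of_nonpos h1, zero_add]
        refine le_add_right ((ENNReal.ofReal_le_ofReal ?_).trans ENNReal.ofReal_add_le)
        linarith
      · rw [ENNReal.ofReal_of_nonpos h2, add_zero, add_right_comm]
        refine le_add_right ((ENNReal.ofReal_le_ofReal ?_).trans ENNReal.ofReal_add_le)
        linarith
      · rw [← ENNReal.ofReal_add h1 h2, add_assoc]; exact le_add_right le_rfl
    have hfin : P1 + P2 ≠ ⊤ := ENNReal.add_ne_top.2 ⟨hP1, hP2⟩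
    refine (ENNReal.add_le_add_iff_right hfin).1 ?_
    calc ENNReal.ofReal Λ + ENNReal.ofReal Λ + (P1 + P2)
        = (ENNReal.ofReal Λ + P1) + (ENNReal.ofReal Λ + P2) := by ring
      _ ≤ (K1 + A + Q1) + (K2 + B + Q2) := add_le_add a1 b1
      _ = (K1 + A + K2 + B) + (Q1 + Q2) := by ring
      _ ≤ (K1 + A + K2 + B) + (C + P1 + P2) := by gcongr
      _ = _ := by ring
  lift A to ℝ≥0 using hAt with A'
  lift B to ℝ≥0 using hBt with B'
  generalize ETKL c Λ μ ν γ = E at key hEt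
  lift E to ℝ≥0 using hEt with E'
  have : Λ + Λ ≤ E' + A' + B' := by
    have := ENNReal.toReal_mono (by finiteness) key
    rw [ENNReal.toReal_add (by finiteness) (by finiteness), ENNReal.toReal_ofReal hΛ.le,
      ENNReal.toReal_add (by finiteness) (by finiteness),
      ENNReal.toReal_add (by finiteness) (by finiteness)] at this
    exact this
  change ((Λ - (A' : ℝ) + (Λ - (B' : ℝ)) : ℝ) : EReal) ≤ ((E' : ℝ) : EReal)
  rw [EReal.coe_le_coe_iff]
  linarith

theorem kl_dual_scaled {X : Type*} [MetricSpace X] [MeasurableSpace X] [BorelSpace X]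
    (Λ : ℝ) (hΛ : 0 < Λ)
    (μ σ : Measure X) [IsProbabilityMeasure μ] [IsFiniteMeasure σ] (T : ℝ)
    (h : ∀ u : X →ᵇ ℝ, JJ Λ μ u - ∫ x, u x ∂σ ≤ T) :
    ENNReal.ofReal Λ * divergenceF Fkl σ μ ≤ ENNReal.ofReal T := by
  have := kl_dual μ σ (T / Λ) (fun s => by
    have hs := h ((-Λ) • s)
    have e1 : JJ Λ μ ((-Λ) • s : X →ᵇ ℝ) = -Λ * ∫ x, (Real.exp (s x) - 1) ∂μ := by
      rw [JJ, ← integral_const_mul]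
      refine integral_congr_ae (Eventually.of_forall fun x => ?_)
      have : -(((-Λ) • s : X →ᵇ ℝ) x) / Λ = s x := by simp; field_simp
      simp only [this]; ring
    have e2 : ∫ x, ((-Λ) • s : X →ᵇ ℝ) x ∂σ = -Λ * ∫ x, s x ∂σ := by
      rw [← integral_const_mul]; rfl
    rw [e1, e2] at hs
    rw [le_div_iff₀ hΛ]
    linarith)
  refine (mul_le_mul_right this _).trans ?_
  rw [← ENNReal.ofReal_mul hΛ.le, mul_div_cancel₀ _ hΛ.ne']

theorem marg_tight {X : Type*} [MetricSpace X] [ProperSpace X] [MeasurableSpace X] [BorelSpace X]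
    (Λ : ℝ) (hΛ : 0 < Λ) (μ : Measure X) [IsProbabilityMeasure μ] (M : ℝ)
    (l : (X →ᵇ ℝ) →ₗ[ℝ] ℝ) (h : ∀ u : X →ᵇ ℝ, JJ Λ μ u - l u ≤ M) (ε : ℝ) (hε : 0 < ε) :
    ∃ η : C_c(X, ℝ), (∀ z, 0 ≤ η z ∧ η z ≤ 1) ∧ l (1 - ccToBcf η) ≤ ε := by
  have hM0 : 0 ≤ M := by
    have := h 0
    rw [JJ_zero, map_zero] at this; linarith
  obtain ⟨s, hs, hsM⟩ : ∃ s > 0, M ≤ s * (ε / 2) :=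
    ⟨2 * (M + 1) / ε, by positivity, by field_simp; linarith⟩
  set δ := s * (ε / 2) / (Λ * Real.exp (s / Λ)) with hδ
  have hδ0 : 0 < δ := by positivity
  obtain ⟨K, hK, hKμ⟩ : ∃ K : Set X, IsCompact K ∧ μ Kᶜ ≤ ENNReal.ofReal δ := by
    have := (isTightMeasureSet_singleton (μ := μ))
    rw [isTightMeasureSet_iff_exists_isCompact_measure_compl_le] at this
    obtain ⟨K, hK, h⟩ := this (ENNReal.ofReal δ) (by simpa using hδ0)
    exact ⟨K, hK, h μ rfl⟩
  obtain ⟨f, hf1, -, hfc, hf01⟩ := exists_continuous_one_zero_of_isCompact hK isClosed_empty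
      (Set.disjoint_empty K)
  let η : C_c(X, ℝ) := ⟨f, hfc⟩
  refine ⟨η, hf01, ?_⟩
  set χ : X →ᵇ ℝ := 1 - ccToBcf η with hχ
  have hχe : ∀ x, χ x = 1 - f x := fun x => rfl
  have h1 := h ((-s) • χ)
  rw [map_smul, smul_eq_mul] at h1
  have hmK : MeasurableSet Kᶜ := hK.isClosed.measurableSet.compl
  have h2 : -(Λ * Real.exp (s / Λ) * μ.real Kᶜ) ≤ JJ Λ μ ((-s) • χ : X →ᵇ ℝ) := by
    have : -(Λ * Real.exp (s / Λ) * μ.real Kᶜ)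
        = ∫ x, Kᶜ.indicator (fun _ => -(Λ * Real.exp (s / Λ))) x ∂μ := by
      rw [integral_indicator hmK]; simp; ring
    rw [this]
    refine integral_mono ((integrable_const _).indicator hmK) (JJ_int Λ hΛ μ _) fun x => ?_
    have e : -(((-s) • χ : X →ᵇ ℝ) x) / Λ = s * (1 - f x) / Λ := by simp [hχe]
    simp only [e]
    by_cases hx : x ∈ K
    · have : f x = 1 := hf1 hx
      simp [hx, this]
    · rw [Set.indicator_of_mem (by simpa using hx)]
      have : Real.exp (s * (1 - f x) / Λ) ≤ Real.exp (s / Λ) := by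
        refine Real.exp_le_exp.2 (div_le_div_of_nonneg_right ?_ hΛ.le)
        nlinarith [(hf01 x).1]
      nlinarith
  have h3 : Λ * Real.exp (s / Λ) * μ.real Kᶜ ≤ s * (ε / 2) := by
    have : μ.real Kᶜ ≤ δ := ENNReal.toReal_le_of_le_ofReal hδ0.le hKμ
    rw [hδ, le_div_iff₀ (by positivity)] at this
    linarith
  have : s * l χ ≤ s * ε := by nlinarith
  exact le_of_mul_le_mul_left this hs

theorem strong_aux {X : Type*} [MetricSpace X] [ProperSpace X] [MeasurableSpace X] [BorelSpace X]
    (c : X × X → ℝ≥0∞) (hc : LowerSemicontinuous c) (Λ : ℝ) (hΛ : 0 < Λ) (μ ν : Measure X)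
    [IsProbabilityMeasure μ] [IsProbabilityMeasure ν] (M : ℝ)
    (hM : ∀ u v : X →ᵇ ℝ, (∀ x y, ENNReal.ofReal (u x + v y) ≤ c (x, y)) →
      JJ Λ μ u + JJ Λ ν v ≤ M) :
    ∃ γ : Measure (X × X), IsFiniteMeasure γ ∧
      ∫⁻ p, c p ∂γ + ENNReal.ofReal Λ * divergenceF Fkl (γ.map Prod.fst) μ
        + ENNReal.ofReal Λ * divergenceF Fkl (γ.map Prod.snd) ν ≤ ENNReal.ofReal M := by
  obtain ⟨l, hpos, hl⟩ := hahn_banach_dual c Λ hΛ μ ν M hM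
  let p1 : C(X × X, X) := ⟨Prod.fst, continuous_fst⟩
  let p2 : C(X × X, X) := ⟨Prod.snd, continuous_snd⟩
  let l1 : (X →ᵇ ℝ) →ₗ[ℝ] ℝ :=
    { toFun := fun u => l (u.compContinuous p1)
      map_add' := fun u v => by rw [← map_add]; rfl
      map_smul' := fun a u => by rw [RingHom.id_apply, ← map_smul]; rfl }
  let l2 : (X →ᵇ ℝ) →ₗ[ℝ] ℝ :=
    { toFun := fun u => l (u.compContinuous p2)
      map_add' := fun u v => by rw [← map_add]; rfl
      map_smul' := fun a u => by rw [RingHom.id_apply, ← map_smul]; rfl }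
  have main : ∀ (u v : X →ᵇ ℝ) (φ : X × X →ᵇ ℝ), (∀ z, ENNReal.ofReal (φ z) ≤ c z) →
      (JJ Λ μ u - l1 u) + (JJ Λ ν v - l2 v) + l φ ≤ M := by
    intro u v φ hφ
    have := hl u v (φ - u.compContinuous p1 - v.compContinuous p2) (fun x y => by
      refine le_trans (le_of_eq ?_) (hφ (x, y))
      congr 1
      simp [p1, p2])
    rw [map_sub, map_sub] at this
    change _ + (l φ - l1 u - l2 v) ≤ M at this
    linarith
  have z0 : ∀ z : X × X, ENNReal.ofReal ((0 : X × X →ᵇ ℝ) z) ≤ c z := fun z => by simp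
  have t1 := marg_tight Λ hΛ μ M l1 (fun u => by
    have := main u 0 0 z0
    rw [JJ_zero, map_zero, map_zero] at this; linarith)
  have t2 := marg_tight Λ hΛ ν M l2 (fun u => by
    have := main 0 u 0 z0
    rw [JJ_zero, map_zero, map_zero] at this; linarith)
  obtain ⟨γ, hγ, hIntg⟩ := riesz_tight l hpos (by
    intro ε hε
    obtain ⟨η1, h1, k1⟩ := t1 (ε / 2) (by positivity)
    obtain ⟨η2, h2, k2⟩ := t2 (ε / 2) (by positivity)
    let θ : C_c(X × X, ℝ) := ⟨⟨fun z => η1 z.1 * η2 z.2, by fun_prop⟩,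
      HasCompactSupport.intro (η1.hasCompactSupport.isCompact.prod η2.hasCompactSupport.isCompact)
        (by
          rintro ⟨x, y⟩ hz
          simp only
          by_contra hne
          refine hz ⟨subset_tsupport _ ?_, subset_tsupport _ ?_⟩
          · exact left_ne_zero_of_mul hne
          · exact right_ne_zero_of_mul hne)⟩
    have hθ : ∀ x y, θ (x, y) = η1 x * η2 y := fun x y => rfl
    refine ⟨θ, ?_, ?_⟩
    · rintro ⟨x, y⟩
      rw [hθ]
      exact ⟨mul_nonneg (h1 x).1 (h2 y).1, mul_le_one₀ (h1 x).2 (h2 y).1 (h2 y).2⟩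
    · have hp := hpos ((1 - ccToBcf η1).compContinuous p1 + (1 - ccToBcf η2).compContinuous p2
        - (1 - ccToBcf θ)) (by
          rintro ⟨x, y⟩
          have a1 := h1 x
          have a2 := h2 y
          simp [p1, p2, hθ]
          nlinarith)
      rw [map_sub, map_add] at hp
      change 0 ≤ l1 _ + l2 _ - _ at hp
      linarith)
  have hi1 : ∀ u : X →ᵇ ℝ, ∫ x, u x ∂(γ.map Prod.fst) = l1 u := by
    intro u
    rw [integral_map measurable_fst.aemeasurable u.continuous.aestronglyMeasurable]
    exact hIntg (u.compContinuous p1)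
  have hi2 : ∀ u : X →ᵇ ℝ, ∫ x, u x ∂(γ.map Prod.snd) = l2 u := by
    intro u
    rw [integral_map measurable_snd.aemeasurable u.continuous.aestronglyMeasurable]
    exact hIntg (u.compContinuous p2)
  refine ⟨γ, hγ, ?_⟩
  set K1 := ENNReal.ofReal Λ * divergenceF Fkl (γ.map Prod.fst) μ
  set K2 := ENNReal.ofReal Λ * divergenceF Fkl (γ.map Prod.snd) ν
  have s1 : ∀ (v : X →ᵇ ℝ) (φ : X × X →ᵇ ℝ), (∀ z, ENNReal.ofReal (φ z) ≤ c z) →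
      K1 ≤ ENNReal.ofReal (M - (JJ Λ ν v - l2 v) - l φ) ∧
        0 ≤ M - (JJ Λ ν v - l2 v) - l φ := by
    intro v φ hφ
    refine ⟨kl_dual_scaled Λ hΛ μ _ _ fun u => ?_, ?_⟩
    · rw [hi1]; have := main u v φ hφ; linarith
    · have := main 0 v φ hφ
      rw [JJ_zero, map_zero] at this; linarith
  have hK1 : K1 ≠ ⊤ := ne_top_of_le_ne_top ENNReal.ofReal_ne_top (s1 0 0 z0).1
  have s2 : ∀ (φ : X × X →ᵇ ℝ), (∀ z, ENNReal.ofReal (φ z) ≤ c z) →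
      K2 ≤ ENNReal.ofReal (M - K1.toReal - l φ) ∧ 0 ≤ M - K1.toReal - l φ := by
    intro φ hφ
    have aux : ∀ v : X →ᵇ ℝ, JJ Λ ν v - l2 v ≤ M - K1.toReal - l φ := by
      intro v
      have := ENNReal.toReal_le_of_le_ofReal (s1 v φ hφ).2 (s1 v φ hφ).1
      linarith
    refine ⟨kl_dual_scaled Λ hΛ ν _ _ fun v => ?_, ?_⟩
    · rw [hi2]; exact aux v
    · have := aux 0
      rw [JJ_zero, map_zero] at this; linarith
  have hK2 : K2 ≠ ⊤ := ne_top_of_le_ne_top ENNReal.ofReal_ne_top (s2 0 z0).1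
  have aux : ∀ φ : X × X →ᵇ ℝ, (∀ z, ENNReal.ofReal (φ z) ≤ c z) →
      l φ ≤ M - K1.toReal - K2.toReal := by
    intro φ hφ
    have := ENNReal.toReal_le_of_le_ofReal (s2 φ hφ).2 (s2 φ hφ).1
    linarith
  have s3 : ∫⁻ p, c p ∂γ ≤ ENNReal.ofReal (M - K1.toReal - K2.toReal) := by
    refine lsc_approx γ c hc _ fun φ hφ => ?_
    rw [hIntg]; exact aux φ hφ
  have h0 : 0 ≤ M - K1.toReal - K2.toReal := by
    have := aux 0 z0
    rwa [map_zero] at this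
  calc _ ≤ ENNReal.ofReal (M - K1.toReal - K2.toReal) + K1 + K2 := by gcongr
    _ = ENNReal.ofReal (M - K1.toReal - K2.toReal) + ENNReal.ofReal K1.toReal
        + ENNReal.ofReal K2.toReal := by
      rw [ENNReal.ofReal_toReal hK1, ENNReal.ofReal_toReal hK2]
    _ = ENNReal.ofReal M := by
      rw [← ENNReal.ofReal_add h0 ENNReal.toReal_nonneg,
        ← ENNReal.ofReal_add (by positivity) ENNReal.toReal_nonneg]
      congr 1; ring

theorem dualKL_eq_JJ {d : ℕ} (Λ : ℝ) (hΛ : 0 < Λ) (μ ν : Measure (EuclideanSpace ℝ (Fin d)))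
    [IsProbabilityMeasure μ] [IsProbabilityMeasure ν] (u v : EuclideanSpace ℝ (Fin d) →ᵇ ℝ) :
    dualKL Λ μ ν u v = ((JJ Λ μ u + JJ Λ ν v : ℝ) : EReal) := by
  have aux : ∀ (m : Measure (EuclideanSpace ℝ (Fin d))) [IsProbabilityMeasure m]
      (w : EuclideanSpace ℝ (Fin d) →ᵇ ℝ),
      ((∫⁻ x, ENNReal.ofReal (Λ * Real.exp (-(w x) / Λ)) ∂m : ℝ≥0∞) : EReal)
        = ((Λ - JJ Λ m w : ℝ) : EReal) := by
    intro m _ w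
    have hi := (JJ_exp_int Λ hΛ m w)
    rw [← ofReal_integral_eq_lintegral_ofReal (hi.const_mul Λ)
      (Eventually.of_forall fun x => by positivity), EReal.coe_ennreal_ofReal,
      max_eq_left (integral_nonneg fun x => by positivity)]
    congr 1
    rw [JJ, integral_const_mul, integral_const_mul, integral_sub (integrable_const _) hi]
    simp; ring
  rw [dualKL, aux μ u, aux ν v]
  norm_cast
  ring_nf

/-- strong duality for the KL entropy transport problem:
`inf {E_{Λ,KL}(γ|μ,ν) : γ ∈ M(ℝ^d × ℝ^d)}`
`= sup {D_{Λ,KL-dual}(u,v|μ,ν) : u, v continuous, u(x) + v(y) ≤ c(x,y) for all x,y}`. -/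
theorem ETKL_strong_duality {d : ℕ}
    (c : EuclideanSpace ℝ (Fin d) × EuclideanSpace ℝ (Fin d) → ℝ≥0∞)
    (hc : LowerSemicontinuous c)
    (Λ : ℝ) (hΛ : 0 < Λ)
    (μ ν : Measure (EuclideanSpace ℝ (Fin d)))
    [IsProbabilityMeasure μ] [IsProbabilityMeasure ν] :
    (((⨅ (γ : Measure (EuclideanSpace ℝ (Fin d) × EuclideanSpace ℝ (Fin d)))
        (_ : IsFiniteMeasure γ), ETKL c Λ μ ν γ) : ℝ≥0∞) : EReal)
      = ⨆ (u : EuclideanSpace ℝ (Fin d) → ℝ) (v : EuclideanSpace ℝ (Fin d) → ℝ)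
          (_ : Continuous u) (_ : Continuous v)
          (_ : ∀ x y : EuclideanSpace ℝ (Fin d),
            ((u x + v y : ℝ) : EReal) ≤ ((c (x, y) : ℝ≥0∞) : EReal)),
          dualKL Λ μ ν u v := by
  apply le_antisymm
  · set S := ⨆ (u : EuclideanSpace ℝ (Fin d) → ℝ) (v : EuclideanSpace ℝ (Fin d) → ℝ)
          (_ : Continuous u) (_ : Continuous v)
          (_ : ∀ x y : EuclideanSpace ℝ (Fin d),
            ((u x + v y : ℝ) : EReal) ≤ ((c (x, y) : ℝ≥0∞) : EReal)),
          dualKL Λ μ ν u v with hS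
    have hle : ∀ u v : EuclideanSpace ℝ (Fin d) →ᵇ ℝ,
        (∀ x y, ENNReal.ofReal (u x + v y) ≤ c (x, y)) →
        ((JJ Λ μ u + JJ Λ ν v : ℝ) : EReal) ≤ S := by
      intro u v h
      rw [← dualKL_eq_JJ Λ hΛ μ ν u v, hS]
      exact le_iSup_of_le (u : EuclideanSpace ℝ (Fin d) → ℝ) (le_iSup_of_le
        (v : EuclideanSpace ℝ (Fin d) → ℝ) (le_iSup_of_le u.continuous
        (le_iSup_of_le v.continuous (le_iSup_of_le (fun x y => (ereal_le_iff _ _).2 (h x y))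
          le_rfl))))
    clear_value S
    have h0 : (0 : EReal) ≤ S := by
      have := hle 0 0 (fun x y => by simp)
      rw [JJ_zero, JJ_zero] at this
      simpa using this
    induction S with
    | bot => simp at h0
    | top => exact le_top
    | coe M =>
      obtain ⟨γ, hγ, hE⟩ := strong_aux c hc Λ hΛ μ ν M
        (fun u v h => EReal.coe_le_coe_iff.1 (hle u v h))
      have hM0 : 0 ≤ M := by exact_mod_cast h0
      have : (⨅ (γ : Measure (EuclideanSpace ℝ (Fin d) × EuclideanSpace ℝ (Fin d)))
        (_ : IsFiniteMeasure γ), ETKL c Λ μ ν γ) ≤ ENNReal.ofReal M :=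
        (iInf₂_le γ hγ).trans hE
      refine (EReal.coe_ennreal_le_coe_ennreal_iff.2 this).trans ?_
      rw [EReal.coe_ennreal_ofReal, max_eq_left hM0]
  · refine iSup_le fun u => iSup_le fun v => iSup_le fun hu => iSup_le fun hv => iSup_le fun h => ?_
    have h2 : (dualKL Λ μ ν u v).toENNReal ≤
        ⨅ (γ : Measure (EuclideanSpace ℝ (Fin d) × EuclideanSpace ℝ (Fin d)))
        (_ : IsFiniteMeasure γ), ETKL c Λ μ ν γ := by
      refine le_iInf₂ fun γ hγ => ?_
      have := weak_duality c Λ hΛ μ ν γ u v hu hv h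
      simpa using EReal.toENNReal_le_toENNReal this
    refine le_trans ?_ (EReal.coe_ennreal_le_coe_ennreal_iff.2 h2)
    rw [EReal.coe_toENNReal_eq_max]
    exact le_max_right _ _
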